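/- Let p be a prime, q = p^s with s ≥ 1, let m ≥ 1 and h ≥ 0 be integers with gcd(2h+1, q^m+1) = 1, and let F be a finite field with q^{2m} elements. Suppose x, y, z, w ∈ F are pairwise distinct with x^{q^m+1} = y^{q^m+1} = z^{q^m+1} = w^{q^m+1} = 1, and there are nonzero i, j, k, l ∈ F satisfying i^q = i, j^q = j, k^q = k, l^q = l such that i·x^h + j·y^h + k·z^h + l·w^h = 0 and i·x^{h+1} + j·y^{h+1} + k·z^{h+1} + l·w^{h+1} = 0. Then E(x,z)·E(y,w) = E(y,z)·E(x,w), where E(a,b) = (a^{2h+1} − b^{2h+1})/(a − b). -/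

import Mathlib

/-- Four points `(x, X), …, (w, W)` for which the vectors `(1, x, X, x * X), …` are linearly
dependent have equal cross-ratios, in polynomial form. -/
theorem cross_ratio_of_linear_dependence {F : Type*} [Field F]
    {x y z w X Y Z W a b c d : F} (ha : a ≠ 0)
    (h₁ : a + b + c + d = 0) (hx : a * x + b * y + c * z + d * w = 0)
    (hX : a * X + b * Y + c * Z + d * W = 0)
    (hxX : a * (x * X) + b * (y * Y) + c * (z * Z) + d * (w * W) = 0) :
    (X - Z) * (Y - W) * ((y - z) * (x - w)) = (Y - Z) * (X - W) * ((x - z) * (y - w)) := by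
  refine mul_left_cancel₀ ha ?_
  linear_combination
    ((Z * (w * W) - W * (z * Z)) - (Y * (w * W) - W * (y * Y))
        + (Y * (z * Z) - Z * (y * Y))) * hx
      - (y * (Z * (w * W) - W * (z * Z)) - z * (Y * (w * W) - W * (y * Y))
        + w * (Y * (z * Z) - Z * (y * Y))) * h₁
      + ((z * W - w * Z) - (y * W - w * Y) + (y * Z - z * Y)) * hxX
      - ((z * (w * W) - w * (z * Z)) - (y * (w * W) - w * (y * Y))
        + (y * (z * Z) - z * (y * Y))) * hX

theorem pow_pow_eq_self {M : Type*} [Monoid M] {a : M} {q : ℕ} (ha : a ^ q = a) (m : ℕ) :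
    a ^ q ^ m = a := by
  induction m with
  | zero => simp
  | succ m ih => rw [pow_succ, pow_mul, ih, ha]

/-- A ring endomorphism that fixes the coefficients and inverts the nodes carries a vanishing
weighted power sum to the one with opposite exponent. -/
theorem sum_mul_inv_pow_eq_zero {F : Type*} [Field F] (φ : F →+* F) {x y z w i j k l : F} {n : ℕ}
    (hx : φ x = x⁻¹) (hy : φ y = y⁻¹) (hz : φ z = z⁻¹) (hw : φ w = w⁻¹)
    (hi : φ i = i) (hj : φ j = j) (hk : φ k = k) (hl : φ l = l)
    (hsum : i * x ^ n + j * y ^ n + k * z ^ n + l * w ^ n = 0) :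
    i * x⁻¹ ^ n + j * y⁻¹ ^ n + k * z⁻¹ ^ n + l * w⁻¹ ^ n = 0 := by
  simpa only [map_add, map_mul, map_pow, map_zero, hx, hy, hz, hw, hi, hj, hk, hl]
    using congrArg φ hsum

theorem stmt_4 (p : ℕ) (hp : Nat.Prime p) (s m h : ℕ) (hs : 1 ≤ s) (hm : 1 ≤ m)
    (q : ℕ) (hq : q = p ^ s) (hgcd : Nat.gcd (2 * h + 1) (q ^ m + 1) = 1)
    (F : Type*) [Field F] [Fintype F] (hF : Fintype.card F = q ^ (2 * m))
    (x y z w : F)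
    (hxy : x ≠ y) (hxz : x ≠ z) (hxw : x ≠ w) (hyz : y ≠ z) (hyw : y ≠ w) (hzw : z ≠ w)
    (hx : x ^ (q ^ m + 1) = 1) (hy : y ^ (q ^ m + 1) = 1)
    (hz : z ^ (q ^ m + 1) = 1) (hw : w ^ (q ^ m + 1) = 1)
    (i j k l : F) (hi : i ≠ 0) (hj : j ≠ 0) (hk : k ≠ 0) (hl : l ≠ 0)
    (hiq : i ^ q = i) (hjq : j ^ q = j) (hkq : k ^ q = k) (hlq : l ^ q = l)
    (heq1 : i * x ^ h + j * y ^ h + k * z ^ h + l * w ^ h = 0)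
    (heq2 : i * x ^ (h + 1) + j * y ^ (h + 1) + k * z ^ (h + 1) + l * w ^ (h + 1) = 0) :
    ((x ^ (2 * h + 1) - z ^ (2 * h + 1)) / (x - z)) *
      ((y ^ (2 * h + 1) - w ^ (2 * h + 1)) / (y - w)) =
    ((y ^ (2 * h + 1) - z ^ (2 * h + 1)) / (y - z)) *
      ((x ^ (2 * h + 1) - w ^ (2 * h + 1)) / (x - w)) := by
  have : Fact p.Prime := ⟨hp⟩
  have : CharP F p := by
    apply charP_of_card_eq_prime_pow (f := s * (2 * m))
    rw [hF, hq, ← pow_mul]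
  have hφ (a : F) : iterateFrobenius F p (s * m) a = a ^ q ^ m := by
    rw [iterateFrobenius_def, hq, pow_mul]
  have hinv {a : F} (ha : a ^ (q ^ m + 1) = 1) : iterateFrobenius F p (s * m) a = a⁻¹ := by
    rw [hφ]
    exact eq_inv_of_mul_eq_one_left (by rwa [← pow_succ])
  have hfix {a : F} (ha : a ^ q = a) : iterateFrobenius F p (s * m) a = a :=
    (hφ a).trans (pow_pow_eq_self ha m)
  have hne {a : F} (ha : a ^ (q ^ m + 1) = 1) : a ≠ 0 := by
    rintro rfl
    simp at ha
  have hx0 := hne hx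
  have hy0 := hne hy
  have hz0 := hne hz
  have hw0 := hne hw
  have hinv1 := sum_mul_inv_pow_eq_zero _ (hinv hx) (hinv hy) (hinv hz) (hinv hw)
    (hfix hiq) (hfix hjq) (hfix hkq) (hfix hlq) heq1
  have hinv2 := sum_mul_inv_pow_eq_zero _ (hinv hx) (hinv hy) (hinv hz) (hinv hw)
    (hfix hiq) (hfix hjq) (hfix hkq) (hfix hlq) heq2
  have hshift {a : F} (ha : a ≠ 0) : a⁻¹ ^ (h + 1) * a = a⁻¹ ^ h := by
    rw [pow_succ, mul_assoc, inv_mul_cancel₀ ha, mul_one]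
  have hodd {a : F} (ha : a ≠ 0) : a⁻¹ ^ (h + 1) * a ^ (2 * h + 1) = a ^ h := by
    rw [show 2 * h + 1 = (h + 1) + h by ring, pow_add a (h + 1), ← mul_assoc, ← mul_pow,
      inv_mul_cancel₀ ha, one_pow, one_mul]
  have heven {a : F} (ha : a ≠ 0) : a⁻¹ ^ (h + 1) * (a * a ^ (2 * h + 1)) = a ^ (h + 1) := by
    rw [mul_left_comm, hodd ha, pow_succ']
  have hcross := cross_ratio_of_linear_dependence (x := x) (y := y) (z := z) (w := w)
    (X := x ^ (2 * h + 1)) (Y := y ^ (2 * h + 1)) (Z := z ^ (2 * h + 1)) (W := w ^ (2 * h + 1))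
    (mul_ne_zero hi (pow_ne_zero (h + 1) (inv_ne_zero hx0))) hinv2
    (by simpa only [mul_assoc, hshift hx0, hshift hy0, hshift hz0, hshift hw0] using hinv1)
    (by simpa only [mul_assoc, hodd hx0, hodd hy0, hodd hz0, hodd hw0] using heq1)
    (by simpa only [mul_assoc, heven hx0, heven hy0, heven hz0, heven hw0] using heq2)
  rw [div_mul_div_comm, div_mul_div_comm, div_eq_div_iff
    (mul_ne_zero (sub_ne_zero.2 hxz) (sub_ne_zero.2 hyw))
    (mul_ne_zero (sub_ne_zero.2 hyz) (sub_ne_zero.2 hxw))]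
  exact hcross
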